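/- Let p ∈ (0,1) be constant and fix a constant θ ≥ 0. For each n let k = ⌈n/(γ − x₀ − θ)⌉, k₁ = n − k⌊n/k⌋, k₂ = k − k₁, P = n!/(⌈n/k⌉!^{k₁}·⌊n/k⌋!^{k₂}), f = k₁·C(⌈n/k⌉,2) + k₂·C(⌊n/k⌋,2), and μ_k = P·q^f. Then for every δ > 0, for all sufficiently large n, μ_k/(k₁!·k₂!) ≥ b^{(θ/2 − δ)n}. -/

import Mathlib

/-- `b = 1/(1-p)`. -/
noncomputable def bParam (p : ℝ) : ℝ := 1 / (1 - p)

/-- `γ = γ_p(n) = 2 log_b n − 2 log_b log_b n − 2 log_b 2`. -/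
noncomputable def gammaP (p : ℝ) (n : ℕ) : ℝ :=
  2 * Real.logb (bParam p) n - 2 * Real.logb (bParam p) (Real.logb (bParam p) n)
    - 2 * Real.logb (bParam p) 2

/-- `Δ = γ − ⌊γ⌋`. -/
noncomputable def DeltaP (p : ℝ) (n : ℕ) : ℝ := gammaP p n - ⌊gammaP p n⌋

/-- `φ(x) = (1−Δ+x) log_b(1−Δ+x) + (Δ−x)(1−Δ)/2`. -/
noncomputable def phiFun (b Δ x : ℝ) : ℝ :=
  (1 - Δ + x) * Real.logb b (1 - Δ + x) + (Δ - x) * (1 - Δ) / 2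

/-- `x₀`: the smallest nonnegative solution `x` of `φ(x) ≤ 0`. -/
noncomputable def xZero (b Δ : ℝ) : ℝ := sInf {x : ℝ | 0 ≤ x ∧ phiFun b Δ x ≤ 0}

noncomputable def x0P (p : ℝ) (n : ℕ) : ℝ := xZero (bParam p) (DeltaP p n)

/-- `k = ⌈n/(γ − x₀ − θ)⌉`. -/
noncomputable def kOfθ (p θ : ℝ) (n : ℕ) : ℕ := ⌈(n : ℝ) / (gammaP p n - x0P p n - θ)⌉₊

/-- `k₁ = n − k⌊n/k⌋`, the number of parts of size `⌈n/k⌉` in a `k`-equipartition. -/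
noncomputable def k1Of (p θ : ℝ) (n : ℕ) : ℕ := n - kOfθ p θ n * (n / kOfθ p θ n)

/-- `k₂ = k − k₁`, the number of parts of size `⌊n/k⌋` in a `k`-equipartition. -/
noncomputable def k2Of (p θ : ℝ) (n : ℕ) : ℕ := kOfθ p θ n - k1Of p θ n

/-- `P = n!/(⌈n/k⌉!^{k₁}·⌊n/k⌋!^{k₂})`, the number of ordered `k`-equipartitions. -/
noncomputable def POf (p θ : ℝ) (n : ℕ) : ℝ :=
  (Nat.factorial n : ℝ) /
    ((Nat.factorial ((n + kOfθ p θ n - 1) / kOfθ p θ n) : ℝ) ^ k1Of p θ n *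
      (Nat.factorial (n / kOfθ p θ n) : ℝ) ^ k2Of p θ n)

/-- `f = k₁·C(⌈n/k⌉,2) + k₂·C(⌊n/k⌋,2)`, the number of forbidden edges. -/
noncomputable def fOf (p θ : ℝ) (n : ℕ) : ℕ :=
  k1Of p θ n * Nat.choose ((n + kOfθ p θ n - 1) / kOfθ p θ n) 2 +
    k2Of p θ n * Nat.choose (n / kOfθ p θ n) 2

/-- `μ_k = P·q^f`, the expected number of ordered `k`-equipartitions inducing proper
colourings. -/
noncomputable def muK (p θ : ℝ) (n : ℕ) : ℝ := POf p θ n * (1 - p) ^ fOf p θ n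

theorem mul_log_sub_le_log_factorial (n : ℕ) (hn : 0 < n) :
    (n : ℝ) * Real.log n - n ≤ Real.log (n.factorial : ℝ) := by
  have hn' : (0 : ℝ) < n := by exact_mod_cast hn
  have hf : (0 : ℝ) < n.factorial := by exact_mod_cast n.factorial_pos
  have h := Real.pow_div_factorial_le_exp (n : ℝ) hn'.le n
  have h2 := Real.log_le_log (by positivity) h
  rw [Real.log_div (by positivity) hf.ne', Real.log_pow, Real.log_exp] at h2
  linarith

theorem log_factorial_succ_le (m : ℕ) :
    Real.log ((m + 1).factorial : ℝ) ≤
      ((m : ℝ) + 1) * Real.log ((m : ℝ) + 1) - m + Real.log ((m : ℝ) + 1) := by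
  induction m with
  | zero => simp
  | succ m ih =>
    have hf : (0 : ℝ) < (m + 1).factorial := by exact_mod_cast Nat.factorial_pos _
    have h1 : (0 : ℝ) < (m : ℝ) + 1 := by positivity
    have h2 : (0 : ℝ) < (m : ℝ) + 1 + 1 := by positivity
    have hlog := Real.one_sub_inv_le_log_of_pos (div_pos h2 h1)
    rw [Real.log_div h2.ne' h1.ne', inv_div] at hlog
    have hmul := mul_le_mul_of_nonneg_left hlog h2.le
    have he : ((m : ℝ) + 1 + 1) * (1 - ((m : ℝ) + 1) / ((m : ℝ) + 1 + 1)) = 1 := by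
      field_simp; ring
    rw [he] at hmul
    rw [Nat.factorial_succ]
    push_cast
    rw [Real.log_mul h2.ne' hf.ne']
    nlinarith

theorem log_factorial_le_of_le {m : ℕ} {M : ℝ} (hM : 1 ≤ M) (hm : (m : ℝ) ≤ M) :
    Real.log (m.factorial : ℝ) ≤ m * (Real.log M - 1) + Real.log M + 1 := by
  cases m with
  | zero => simpa using by linarith [Real.log_nonneg hM]
  | succ m =>
    have h := log_factorial_succ_le m
    push_cast at hm ⊢
    have hl := Real.log_le_log (by positivity) hm
    nlinarith [mul_le_mul_of_nonneg_left hl (by positivity : (0 : ℝ) ≤ (m : ℝ) + 1)]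

theorem ceil_div_eq_succ_of_mod_ne_zero {n k : ℕ} (hk : 0 < k) (hr : n - k * (n / k) ≠ 0) :
    (n + k - 1) / k = n / k + 1 := by
  have h := Nat.div_add_mod n k
  have hlt := Nat.mod_lt n hk
  apply Nat.div_eq_of_lt_le
  · rw [Nat.add_mul, mul_comm (n / k)]; omega
  · rw [Nat.add_mul, Nat.add_mul, mul_comm (n / k)]; omega

/-- Lower bound for the logarithm of the expected number of unordered equipartitions of an
`n`-set into `k` independent parts, in terms of the average part size `n / k`. -/
theorem log_equipartitions_lower_bound {n k : ℕ} {p : ℝ} (hp : p < 1) (hk : 0 < k) (hn : 0 < n)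
    (hβ : 0 ≤ -Real.log (1 - p)) :
    (n : ℝ) * Real.log n - n * Real.log ((n : ℝ) / k + 1)
        - k * (Real.log ((n : ℝ) / k + 1) + 1) - k * Real.log k
        + Real.log (1 - p) * ((n : ℝ) * ((n : ℝ) / k - 1) / 2 + k / 8) ≤
      Real.log ((n.factorial : ℝ) /
        ((((n + k - 1) / k).factorial : ℝ) ^ (n - k * (n / k)) *
          ((n / k).factorial : ℝ) ^ (k - (n - k * (n / k)))) *
        (1 - p) ^ ((n - k * (n / k)) * ((n + k - 1) / k).choose 2 +
          (k - (n - k * (n / k))) * (n / k).choose 2) /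
        (((n - k * (n / k)).factorial : ℝ) * ((k - (n - k * (n / k))).factorial : ℝ))) := by
  have hc : n - k * (n / k) = 0 ∨ (n + k - 1) / k = n / k + 1 := by
    by_cases h : n - k * (n / k) = 0
    · exact Or.inl h
    · exact Or.inr (ceil_div_eq_succ_of_mod_ne_zero hk h)
  have hdm := Nat.div_add_mod n k
  have hlt := Nat.mod_lt n hk
  have hsy : ((n / k : ℕ) : ℝ) ≤ (n : ℝ) / k := Nat.cast_div_le
  obtain ⟨r, hr⟩ : ∃ r, r = n - k * (n / k) := ⟨_, rfl⟩
  obtain ⟨s, hs⟩ : ∃ s, s = n / k := ⟨_, rfl⟩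
  obtain ⟨c, hcd⟩ : ∃ c, c = (n + k - 1) / k := ⟨_, rfl⟩
  have hrk : r ≤ k := by omega
  obtain ⟨t, ht⟩ : ∃ t, t = k - r := ⟨_, rfl⟩
  have hns : n = k * s + r := by rw [hs]; omega
  rw [← hr, ← hs, ← hcd] at hc ⊢
  rw [← hs] at hsy
  rw [← ht]
  have hkt : k = r + t := by omega
  have hkR : (0 : ℝ) < k := by exact_mod_cast hk
  have hnR : (0 : ℝ) < n := by exact_mod_cast hn
  have hkt' : (k : ℝ) = r + t := by exact_mod_cast hkt
  have hns' : (n : ℝ) = k * s + r := by exact_mod_cast hns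
  have hq : (0 : ℝ) < 1 - p := by linarith
  have hfac : ∀ m : ℕ, ((m.factorial : ℕ) : ℝ) ≠ 0 := fun m => by
    exact_mod_cast m.factorial_ne_zero
  rw [Real.log_div (by have := hfac; positivity) (mul_ne_zero (hfac _) (hfac _)),
    Real.log_mul (div_ne_zero (hfac _) (mul_ne_zero (pow_ne_zero _ (hfac _))
      (pow_ne_zero _ (hfac _)))) (by positivity),
    Real.log_div (hfac _) (mul_ne_zero (pow_ne_zero _ (hfac _)) (pow_ne_zero _ (hfac _))),
    Real.log_mul (pow_ne_zero _ (hfac _)) (pow_ne_zero _ (hfac _)),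
    Real.log_pow, Real.log_pow, Real.log_pow]
  set M : ℝ := (n : ℝ) / k + 1 with hM
  have hM1 : 1 ≤ M := by rw [hM]; linarith [div_nonneg hnR.le hkR.le]
  have hlow := mul_log_sub_le_log_factorial n hn
  have hsfac : Real.log (s.factorial : ℝ) ≤ s * (Real.log M - 1) + Real.log M + 1 :=
    log_factorial_le_of_le hM1 (by linarith)
  have hcfac : (r : ℝ) * Real.log (c.factorial : ℝ) ≤
      r * (((s : ℝ) + 1) * (Real.log M - 1) + Real.log M + 1) := by
    rcases hc with h0 | h1
    · simp [h0]
    · have := log_factorial_le_of_le (m := s + 1) hM1 (by push_cast; linarith)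
      rw [h1]
      push_cast at this
      exact mul_le_mul_of_nonneg_left this (by positivity)
  have hsfac' := mul_le_mul_of_nonneg_left hsfac (by positivity : (0 : ℝ) ≤ t)
  have hparts : Real.log ((r.factorial : ℝ) * (t.factorial : ℝ)) ≤ k * Real.log k := by
    rw [← Real.log_pow]
    apply Real.log_le_log
    · exact_mod_cast Nat.mul_pos r.factorial_pos t.factorial_pos
    · have h1 : r.factorial * t.factorial ≤ k.factorial := by
        rw [hkt]
        exact Nat.le_of_dvd (Nat.factorial_pos _)
          (Nat.factorial_mul_factorial_dvd_factorial_add r t)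
      exact_mod_cast h1.trans k.factorial_le_pow
  have hedges : ((r * c.choose 2 + t * s.choose 2 : ℕ) : ℝ) ≤
      (n : ℝ) * ((n : ℝ) / k - 1) / 2 + k / 8 := by
    have hf : ((r * c.choose 2 + t * s.choose 2 : ℕ) : ℝ) =
        r * (((s : ℝ) + 1) * s / 2) + t * ((s : ℝ) * (s - 1) / 2) := by
      rcases hc with h0 | h1
      · simp [h0, Nat.cast_choose_two]
      · rw [h1]; push_cast [Nat.cast_choose_two]; ring
    have hid : (n : ℝ) * ((n : ℝ) / k - 1) / 2 + k / 8 -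
        (r * (((s : ℝ) + 1) * s / 2) + t * ((s : ℝ) * (s - 1) / 2)) =
        (2 * r - k) ^ 2 / (8 * k) := by
      have ht' : (t : ℝ) = k - r := by linarith
      rw [ht', hns']
      field_simp
      ring
    have : (0 : ℝ) ≤ (2 * r - k) ^ 2 / (8 * k) := by positivity
    rw [hf]; linarith
  have hedges' := mul_le_mul_of_nonneg_left hedges hβ
  have hsum : (r : ℝ) * (((s : ℝ) + 1) * (Real.log M - 1) + Real.log M + 1) +
      t * (s * (Real.log M - 1) + Real.log M + 1) =
      n * (Real.log M - 1) + k * (Real.log M + 1) := by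
    rw [hns', hkt']; ring
  push_cast at hedges' ⊢
  linarith

theorem xZero_mem_Icc {b Δ : ℝ} (hΔ : 0 ≤ Δ) : xZero b Δ ∈ Set.Icc 0 Δ := by
  refine ⟨Real.sInf_nonneg fun x hx => hx.1, csInf_le ⟨0, fun x hx => hx.1⟩ ⟨hΔ, ?_⟩⟩
  simp [phiFun]

theorem x0P_mem_Icc (p : ℝ) (n : ℕ) : x0P p n ∈ Set.Icc (0 : ℝ) 1 := by
  have h : x0P p n ∈ Set.Icc 0 (DeltaP p n) := xZero_mem_Icc (Int.fract_nonneg _)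
  exact ⟨h.1, h.2.trans (Int.fract_lt_one _).le⟩

open Filter Topology in
theorem tendsto_log_two_mul_add_one_sub :
    Tendsto (fun x : ℝ => Real.log (2 * x + 1) - Real.log x - Real.log 2) atTop (𝓝 0) := by
  have h : Tendsto (fun x : ℝ => Real.log (1 + (2 * x)⁻¹)) atTop (𝓝 0) := by
    have h1 : Tendsto (fun x : ℝ => 1 + (2 * x)⁻¹) atTop (𝓝 (1 + 0)) :=
      tendsto_const_nhds.add
        (tendsto_inv_atTop_zero.comp (tendsto_id.const_mul_atTop (by norm_num)))
    have h2 := h1.log (by norm_num)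
    simpa using h2
  refine h.congr' ?_
  filter_upwards [eventually_gt_atTop 0] with x hx
  have : 1 + (2 * x)⁻¹ = (2 * x + 1) / (x * 2) := by field_simp
  rw [this, Real.log_div (by positivity) (by positivity), Real.log_mul hx.ne' (by norm_num)]
  ring

open Filter Topology in
theorem tendsto_log_div_self : Tendsto (fun x : ℝ => Real.log x / x) atTop (𝓝 0) := by
  have := Real.isLittleO_log_id_atTop.tendsto_div_nhds_zero
  simpa using this

open Filter Topology in
theorem tendsto_div_linear_sub_log (A C : ℝ) :
    Tendsto (fun x : ℝ => x / (2 * x - A * Real.log x - C)) atTop (𝓝 (1 / 2)) := by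
  have h : Tendsto (fun x : ℝ => (2 - A * (Real.log x / x) - C * x⁻¹)⁻¹) atTop (𝓝 (1 / 2)) := by
    have := (((tendsto_const_nhds (x := (2 : ℝ))).sub (tendsto_log_div_self.const_mul A)).sub
      (tendsto_inv_atTop_zero.const_mul C)).inv₀ (by norm_num)
    simpa using this
  refine h.congr' ?_
  filter_upwards [eventually_gt_atTop 0] with x hx
  rw [← inv_div]
  field_simp

open Filter Topology in
theorem tendsto_log_two_mul_add_one_div :
    Tendsto (fun x : ℝ => Real.log (2 * x + 1) / x) atTop (𝓝 0) := by
  have h := (tendsto_log_two_mul_add_one_sub.mul tendsto_inv_atTop_zero).add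
    (tendsto_log_div_self.add (tendsto_inv_atTop_zero.const_mul (Real.log 2)))
  simp only [mul_zero, add_zero] at h
  refine h.congr fun x => ?_
  ring

open Filter Topology in
/-- **(18) Fact (J).** For constant `p ∈ (0,1)` and constant `θ ≥ 0`, with
`k = ⌈n/(γ − x₀ − θ)⌉`: for every `δ > 0` and all sufficiently large `n`,
`μ_k/(k₁!·k₂!) ≥ b^{(θ/2 − δ)n}`. -/
theorem muK_div_factorials_lower_bound
    (p : ℝ) (hp : p ∈ Set.Ioo (0 : ℝ) 1) (θ : ℝ) (hθ : 0 ≤ θ) :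
    ∀ δ > (0 : ℝ), ∃ N : ℕ, ∀ n ≥ N,
      bParam p ^ ((θ / 2 - δ) * (n : ℝ)) ≤
        muK p θ n / ((Nat.factorial (k1Of p θ n) : ℝ) * (Nat.factorial (k2Of p θ n) : ℝ)) := by
  obtain ⟨hp0, hp1⟩ := hp
  have hq : 0 < 1 - p := by linarith
  obtain ⟨β, hβ⟩ : ∃ β, β = -Real.log (1 - p) := ⟨_, rfl⟩
  have hβ0 : 0 < β := by rw [hβ]; linarith [Real.log_neg hq (by linarith)]
  have hlogb : Real.log (bParam p) = β := by rw [bParam, one_div, Real.log_inv, hβ]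
  have hb0 : 0 < bParam p := by rw [bParam]; positivity
  intro δ hδ
  set C : ℝ := 2 * (Real.log 2 / β) + 1 + θ with hC
  have hL : Tendsto (fun n : ℕ => Real.log n / β) atTop atTop :=
    (Real.tendsto_log_atTop.comp tendsto_natCast_atTop_atTop).atTop_div_const hβ0
  have hκ : Tendsto (fun n : ℕ => Real.log n / β /
      (2 * (Real.log n / β) - 2 / β * Real.log (Real.log n / β) - C) + Real.log n / n / β)
      atTop (𝓝 (1 / 2)) := by
    have h1 := (tendsto_div_linear_sub_log (2 / β) C).comp hL
    have h2 := (tendsto_log_div_self.comp (tendsto_natCast_atTop_atTop (R := ℝ))).div_const β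
    simpa using h1.add h2
  have hinv : Tendsto (fun n : ℕ => (Real.log n / β)⁻¹) atTop (𝓝 0) :=
    tendsto_inv_atTop_zero.comp hL
  have hA := tendsto_log_two_mul_add_one_sub.comp hL
  have hB := tendsto_log_two_mul_add_one_div.comp hL
  have herr := (hA.div_const β).add (hκ.mul ((tendsto_const_nhds (x := (1 : ℝ))).add
    ((hB.div_const β).add (hinv.const_mul (1 / β + 1 / 8)))))
  have hev := herr.eventually_lt_const (u := 1 / 2 + δ) (by simpa using hδ)
  have hu1 : Tendsto (fun n : ℕ => 2 * (Real.log n / β) - 2 / β * Real.log (Real.log n / β) - C)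
      atTop atTop := by
    have h1 : Tendsto (fun x : ℝ => x * (2 - 2 / β * (Real.log x / x) - C * x⁻¹)) atTop atTop := by
      refine tendsto_id.atTop_mul_pos (C := 2) (by norm_num) ?_
      simpa using ((tendsto_const_nhds (x := (2 : ℝ))).sub
        (tendsto_log_div_self.const_mul (2 / β))).sub (tendsto_inv_atTop_zero.const_mul C)
    refine (h1.comp hL).congr' ?_
    filter_upwards [hL.eventually_gt_atTop 0] with n hn
    simp only [Function.comp]
    generalize Real.log n / β = x at hn ⊢
    field_simp
  obtain ⟨N, hN⟩ := eventually_atTop.1 (hev.and ((hu1.eventually_ge_atTop 1).and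
    ((hL.eventually_ge_atTop 1).and (eventually_ge_atTop 1))))
  refine ⟨N, fun n hn => ?_⟩
  obtain ⟨hE, hu, hL1, hn1⟩ := hN n hn
  simp only [Function.comp] at hE
  have hn0 : 0 < n := hn1
  have hnR : (0 : ℝ) < n := by exact_mod_cast hn0
  obtain ⟨L, hLd⟩ : ∃ L, L = Real.log n / β := ⟨_, rfl⟩
  have hlogn : Real.log n = β * L := by rw [hLd]; field_simp
  rw [← hLd] at hE hu hL1
  obtain ⟨hx0, hx1⟩ := x0P_mem_Icc p n
  have hγ : gammaP p n = 2 * L - 2 * (Real.log L / β) - 2 * (Real.log 2 / β) := by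
    simp only [gammaP, Real.logb, hlogb, ← hLd]
  set v : ℝ := 2 * L - 2 / β * Real.log L - C with hv
  set u : ℝ := gammaP p n - x0P p n - θ with hud
  have hvu : v ≤ u := by
    rw [hud, hγ, hv, hC]
    have : 2 / β * Real.log L = 2 * (Real.log L / β) := by ring
    linarith
  have hu0 : 0 < u := by linarith
  obtain ⟨k, hk⟩ : ∃ k, k = kOfθ p θ n := ⟨_, rfl⟩
  have hkc : k = ⌈(n : ℝ) / u⌉₊ := by rw [hk, kOfθ]
  have hkge : (n : ℝ) / u ≤ k := by rw [hkc]; exact Nat.le_ceil _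
  have hkR : (0 : ℝ) < k := (div_pos hnR hu0).trans_le hkge
  have hk0 : 0 < k := by exact_mod_cast hkR
  have hkn : k ≤ n := by
    rw [hkc]
    exact Nat.ceil_le.2 (div_le_self hnR.le (by linarith))
  have hkle : (k : ℝ) ≤ n / v + 1 := by
    rw [hkc]
    refine (Nat.ceil_lt_add_one (by positivity)).le.trans ?_
    gcongr
  have hy : (n : ℝ) / k ≤ u := by
    rw [div_le_iff₀ hkR]
    rw [div_le_iff₀ hu0] at hkge
    linarith
  have hlogL : 0 ≤ Real.log L := Real.log_nonneg hL1
  have hlog2 : 0 < Real.log 2 := Real.log_pos (by norm_num)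
  have huγ : u ≤ 2 * L - 2 * (Real.log L / β) - 2 * (Real.log 2 / β) - θ := by
    rw [hud, hγ]; linarith
  have huL : u ≤ 2 * L := by
    have := div_nonneg hlogL hβ0.le
    have := div_nonneg hlog2.le hβ0.le
    linarith
  have hkey := log_equipartitions_lower_bound hp1 hk0 hn0 (by rw [← hβ]; exact hβ0.le)
  have hMlog : Real.log ((n : ℝ) / k + 1) ≤ Real.log (2 * L + 1) :=
    Real.log_le_log (by positivity) (by linarith)
  have hklog : Real.log k ≤ β * L := by
    rw [← hlogn]
    exact Real.log_le_log hkR (by exact_mod_cast hkn)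
  set W : ℝ := Real.log (2 * L + 1) with hW
  have hW0 : 0 ≤ W := Real.log_nonneg (by linarith)
  have hmain : β * ((θ / 2 - δ) * n) ≤ (n : ℝ) * Real.log n - n * Real.log ((n : ℝ) / k + 1)
        - k * (Real.log ((n : ℝ) / k + 1) + 1) - k * Real.log k
        + Real.log (1 - p) * ((n : ℝ) * ((n : ℝ) / k - 1) / 2 + k / 8) := by
    have e1 := mul_le_mul_of_nonneg_left hMlog hnR.le
    have e2 := mul_le_mul_of_nonneg_left hMlog hkR.le
    have e3 := mul_le_mul_of_nonneg_left hklog hkR.le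
    have e4 := mul_le_mul_of_nonneg_left (hy.trans huγ) (mul_nonneg hβ0.le hnR.le)
    have e4' : β * n * (2 * L - 2 * (Real.log L / β) - 2 * (Real.log 2 / β) - θ) =
        2 * (n * (β * L)) - 2 * (n * Real.log L) - 2 * (n * Real.log 2) - β * n * θ := by
      field_simp
    have e5 := mul_le_mul_of_nonneg_right hkle
      (by positivity : 0 ≤ β * L + W + 1 + β / 8)
    have e6 := mul_le_mul_of_nonneg_left hE.le (mul_nonneg hβ0.le hnR.le)
    have e6' : β * n * ((W - Real.log L - Real.log 2) / β +
        (L / v + Real.log n / n / β) * (1 + (W / L / β + (1 / β + 1 / 8) * L⁻¹))) =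
        n * (W - Real.log L - Real.log 2) + (n / v + 1) * (β * L + W + 1 + β / 8) := by
      have hv0 : v ≠ 0 := by linarith
      have hL0 : L ≠ 0 := by linarith
      rw [hlogn]
      clear_value v W
      field_simp
      ring
    have hlq : Real.log (1 - p) = -β := by linarith
    rw [hlq, hlogn]
    linarith
  have hpos : 0 < muK p θ n /
      ((Nat.factorial (k1Of p θ n) : ℝ) * (Nat.factorial (k2Of p θ n) : ℝ)) := by
    simp only [muK, POf]
    positivity
  rw [Real.rpow_def_of_pos hb0, hlogb, ← Real.le_log_iff_exp_le hpos]
  refine hmain.trans (hkey.trans_eq ?_)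
  simp only [muK, POf, fOf, k2Of, k1Of, ← hk]
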